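/- Let μ be a doubling measure on ℝⁿ and let φ be a quasi-submultiplicative Young function with constant c > 0 which is differentiable for t > 1, and suppose there are constants [φ]₁ > 0 and [φ]₂ > 0 such that [φ]₁ φ(t) ≤ t φ'(t) ≤ [φ]₂ φ(t) for all t > 1. Then for every cube Q in ℝⁿ and every f ∈ BMO(dμ): ‖f − f_{Q,μ}‖_{φ(L)(Q, dμ/μ(Q))} ≤ c_μ 2^{n_μ} φ(c (1 + 1/[φ]₁)) ([φ]₂ + 1) ‖f‖_{BMO(dμ)}. -/

import Mathlib

open MeasureTheory Set Filter
open scoped ENNReal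

noncomputable section

/-- An axis-parallel cube in `ℝⁿ`, given by its lower corner and (positive) sidelength. -/
structure Cube (n : ℕ) where
  corner : Fin n → ℝ
  side : ℝ
  side_pos : 0 < side

/-- The set of points of a cube. -/
def Cube.carrier {n : ℕ} (Q : Cube n) : Set (Fin n → ℝ) :=
  {x | ∀ i, Q.corner i ≤ x i ∧ x i ≤ Q.corner i + Q.side}

/-- A Borel measure on `ℝⁿ` is doubling with doubling constant `c ≥ 1` and doubling
dimension `d > 0`: every cube has finite positive measure and
`μ(Q̃) ≤ c (ℓ(Q̃)/ℓ(Q))^d μ(Q)` whenever `Q ⊆ Q̃`. -/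
def IsDoubling {n : ℕ} (μ : Measure (Fin n → ℝ)) (c d : ℝ) : Prop :=
  1 ≤ c ∧ 0 < d ∧ (∀ Q : Cube n, 0 < μ Q.carrier ∧ μ Q.carrier < ⊤) ∧
    ∀ Q Q' : Cube n, Q.carrier ⊆ Q'.carrier →
      μ Q'.carrier ≤ ENNReal.ofReal (c * (Q'.side / Q.side) ^ d) * μ Q.carrier

/-- `f_{Q,μ}`, the `μ`-average of `f` over the cube `Q`. -/
def cubeAvg {n : ℕ} (μ : Measure (Fin n → ℝ)) (Q : Cube n) (f : (Fin n → ℝ) → ℝ) : ℝ :=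
  ⨍ x in Q.carrier, f x ∂μ

/-- The mean oscillation of `f` over the cube `Q`. -/
def osc {n : ℕ} (μ : Measure (Fin n → ℝ)) (Q : Cube n) (f : (Fin n → ℝ) → ℝ) : ℝ :=
  ⨍ x in Q.carrier, |f x - cubeAvg μ Q f| ∂μ

/-- The `BMO(dμ)` norm: supremum of the mean oscillations over all cubes. -/
def bmoNorm {n : ℕ} (μ : Measure (Fin n → ℝ)) (f : (Fin n → ℝ) → ℝ) : ℝ :=
  ⨆ Q : Cube n, osc μ Q f

/-- Membership in `BMO(dμ)`: local integrability together with a finite supremum of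
mean oscillations. -/
def MemBMO {n : ℕ} (μ : Measure (Fin n → ℝ)) (f : (Fin n → ℝ) → ℝ) : Prop :=
  LocallyIntegrable f μ ∧ BddAbove (Set.range fun Q : Cube n => osc μ Q f)

/-- The local Luxemburg norm `‖f‖_{φ(L)(Q, dν/ν(Q))}`. -/
def luxNorm {n : ℕ} (φ : ℝ → ℝ) (ν : Measure (Fin n → ℝ)) (Q : Cube n)
    (f : (Fin n → ℝ) → ℝ) : ℝ :=
  sInf {l : ℝ | 0 < l ∧
    ∫⁻ x in Q.carrier, ENNReal.ofReal (φ (|f x| / l)) ∂ν ≤ ν Q.carrier}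

/-- The local variable-exponent Luxemburg norm `‖f‖_{L^{p(·)}(Q, dx/|Q|)}`. -/
def vpLuxNorm {n : ℕ} (p : (Fin n → ℝ) → ℝ) (Q : Cube n) (f : (Fin n → ℝ) → ℝ) : ℝ :=
  sInf {l : ℝ | 0 < l ∧
    ∫⁻ x in Q.carrier, ENNReal.ofReal ((|f x| / l) ^ p x) ≤ volume Q.carrier}

/-- A Young function: convex on `[0,∞)` with `φ(0) = 0`, `φ(1) = 1` and `φ(t) → ∞`. -/
def IsYoung (φ : ℝ → ℝ) : Prop :=
  ConvexOn ℝ (Set.Ici 0) φ ∧ φ 0 = 0 ∧ φ 1 = 1 ∧ Tendsto φ atTop atTop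

open scoped Topology

namespace Cube

variable {n : ℕ}

lemma carrier_eq_closedBall (Q : Cube n) :
    Q.carrier = Metric.closedBall (fun i => Q.corner i + Q.side / 2) (Q.side / 2) := by
  ext x
  have hs := Q.side_pos
  simp only [carrier, mem_ofPred_eq, Metric.mem_closedBall]
  rw [dist_pi_le_iff (by positivity)]
  refine forall_congr' fun i => ?_
  rw [Real.dist_eq, abs_le]
  constructor <;> rintro ⟨h₁, h₂⟩ <;> constructor <;> linarith

lemma isCompact_carrier (Q : Cube n) : IsCompact Q.carrier := by
  rw [carrier_eq_closedBall]
  exact isCompact_closedBall _ _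

lemma measurableSet_carrier (Q : Cube n) : MeasurableSet Q.carrier :=
  Q.isCompact_carrier.isClosed.measurableSet

/-- The cube that is the closed ball of centre `x` and radius `r` in the sup norm. -/
def ofBall (x : Fin n → ℝ) (r : ℝ) (hr : 0 < r) : Cube n where
  corner i := x i - r
  side := 2 * r
  side_pos := by positivity

lemma carrier_ofBall (x : Fin n → ℝ) (r : ℝ) (hr : 0 < r) :
    (ofBall x r hr).carrier = Metric.closedBall x r := by
  rw [carrier_eq_closedBall]
  congr 1
  · ext i
    simp [ofBall]
  · simp [ofBall]

/-- The index of the half-open dyadic subcube of generation `k` of `Q` which contains `x`. -/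
def dyadicIndex (Q : Cube n) (k : ℕ) (x : Fin n → ℝ) : Fin n → ℤ :=
  fun i => ⌊2 ^ k * ((x i - Q.corner i) / Q.side)⌋

/-- The closed dyadic cube of generation `k` and index `m`, relative to `Q`. -/
def dyadic (Q : Cube n) (k : ℕ) (m : Fin n → ℤ) : Cube n where
  corner i := Q.corner i + m i * (Q.side / 2 ^ k)
  side := Q.side / 2 ^ k
  side_pos := div_pos Q.side_pos (by positivity)

lemma measurable_dyadicIndex (Q : Cube n) (k : ℕ) : Measurable (Q.dyadicIndex k) := by
  refine measurable_pi_lambda _ fun i => ?_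
  exact Int.measurable_floor.comp (by fun_prop)

lemma dyadic_zero (Q : Cube n) : Q.dyadic 0 0 = Q := by
  simp [dyadic]

lemma dyadicIndex_succ (Q : Cube n) (k : ℕ) (x : Fin n → ℝ) (i : Fin n) :
    Q.dyadicIndex k x i = Q.dyadicIndex (k + 1) x i / 2 := by
  have h := Int.floor_div_natCast (2 ^ (k + 1) * ((x i - Q.corner i) / Q.side)) 2
  rw [Nat.cast_ofNat, Nat.cast_ofNat] at h
  simp only [dyadicIndex]
  rw [← h]
  congr 1
  ring

lemma dyadicIndex_eq_of_le (Q : Cube n) {j k : ℕ} (hjk : j ≤ k) {x y : Fin n → ℝ}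
    (h : Q.dyadicIndex k x = Q.dyadicIndex k y) : Q.dyadicIndex j x = Q.dyadicIndex j y := by
  induction k, hjk using Nat.le_induction with
  | base => exact h
  | succ k _ ih =>
    refine ih (funext fun i => ?_)
    rw [Q.dyadicIndex_succ k x, Q.dyadicIndex_succ k y, h]

lemma dyadicIndex_eq_iff (Q : Cube n) (k : ℕ) (m : Fin n → ℤ) (x : Fin n → ℝ) :
    Q.dyadicIndex k x = m ↔ ∀ i, (Q.dyadic k m).corner i ≤ x i ∧
      x i < (Q.dyadic k m).corner i + (Q.dyadic k m).side := by
  have hs := Q.side_pos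
  rw [funext_iff]
  refine forall_congr' fun i => ?_
  have h2 : (0 : ℝ) < 2 ^ k := by positivity
  have e : 2 ^ k * ((x i - Q.corner i) / Q.side) = (x i - Q.corner i) / (Q.side / 2 ^ k) := by
    field_simp
  have hs' : 0 < Q.side / 2 ^ k := by positivity
  simp only [dyadicIndex, dyadic]
  rw [Int.floor_eq_iff, e, le_div_iff₀ hs', div_lt_iff₀ hs']
  constructor <;> rintro ⟨h₁, h₂⟩ <;> constructor <;> linarith

lemma mem_dyadic_of_dyadicIndex_eq (Q : Cube n) {k : ℕ} {m : Fin n → ℤ} {x : Fin n → ℝ}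
    (h : Q.dyadicIndex k x = m) : x ∈ (Q.dyadic k m).carrier := fun i =>
  ⟨((Q.dyadicIndex_eq_iff k m x).1 h i).1, ((Q.dyadicIndex_eq_iff k m x).1 h i).2.le⟩

lemma dyadic_subset_parent (Q : Cube n) (k : ℕ) (x : Fin n → ℝ) :
    (Q.dyadic (k + 1) (Q.dyadicIndex (k + 1) x)).carrier ⊆
      (Q.dyadic k (Q.dyadicIndex k x)).carrier := by
  intro y hy i
  obtain ⟨h₁, h₂⟩ := hy i
  have hs := Q.side_pos
  have hs' : 0 < Q.side / 2 ^ (k + 1) := by positivity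
  have e : Q.side / 2 ^ k = 2 * (Q.side / 2 ^ (k + 1)) := by
    field_simp
    ring
  simp only [dyadic] at h₁ h₂ ⊢
  rw [e, dyadicIndex_succ]
  set a := Q.dyadicIndex (k + 1) x i
  set t := Q.side / 2 ^ (k + 1)
  have l₁ : ((a / 2 : ℤ) : ℝ) * 2 ≤ a := by
    have : a / 2 * 2 ≤ a := by omega
    exact_mod_cast this
  have l₂ : (a : ℝ) ≤ ((a / 2 : ℤ) : ℝ) * 2 + 1 := by
    have : a ≤ a / 2 * 2 + 1 := by omega
    exact_mod_cast this
  constructor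
  · nlinarith
  · nlinarith

end Cube

namespace IsDoubling

variable {n : ℕ} {μ : Measure (Fin n → ℝ)} {c d : ℝ}

lemma isLocallyFiniteMeasure (hμ : IsDoubling μ c d) : IsLocallyFiniteMeasure μ := by
  refine ⟨fun x => ⟨Metric.closedBall x 1, Metric.closedBall_mem_nhds x one_pos, ?_⟩⟩
  rw [← Cube.carrier_ofBall x 1 one_pos]
  exact (hμ.2.2.1 _).2

lemma measure_le_of_side_eq (hμ : IsDoubling μ c d) {P P' : Cube n}
    (hP : P.carrier ⊆ P'.carrier) (hside : P'.side = 2 * P.side) :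
    μ P'.carrier ≤ ENNReal.ofReal (c * 2 ^ d) * μ P.carrier := by
  have h := hμ.2.2.2 P P' hP
  rwa [hside, mul_div_cancel_right₀ _ P.side_pos.ne'] at h

lemma isUnifLocDoublingMeasure (hμ : IsDoubling μ c d) : IsUnifLocDoublingMeasure μ := by
  refine ⟨⟨(c * 2 ^ d).toNNReal, ?_⟩⟩
  filter_upwards [self_mem_nhdsWithin] with r hr x
  have hr : 0 < r := hr
  rw [← Cube.carrier_ofBall x r hr, ← Cube.carrier_ofBall x (2 * r) (by positivity)]
  refine hμ.measure_le_of_side_eq ?_ rfl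
  rw [Cube.carrier_ofBall, Cube.carrier_ofBall]
  exact Metric.closedBall_subset_closedBall (by linarith)

lemma measure_real_pos (hμ : IsDoubling μ c d) (P : Cube n) : 0 < μ.real P.carrier :=
  ENNReal.toReal_pos (hμ.2.2.1 P).1.ne' (hμ.2.2.1 P).2.ne

lemma one_le_const (hμ : IsDoubling μ c d) : 1 ≤ c * 2 ^ d :=
  one_le_mul_of_one_le_of_one_le hμ.1 (Real.one_le_rpow one_le_two hμ.2.1.le)

lemma measure_hyperplane (hμ : IsDoubling μ c d) (i : Fin n) (t : ℝ) :
    μ {x | x i = t} = 0 := by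
  have := hμ.isLocallyFiniteMeasure
  have := hμ.isUnifLocDoublingMeasure
  have hE : MeasurableSet {x : Fin n → ℝ | x i = t} :=
    measurableSet_eq_fun (measurable_pi_apply i) measurable_const
  have h := (ae_restrict_iff' hE).1
    (IsUnifLocDoublingMeasure.ae_tendsto_measure_inter_div μ {x | x i = t} 2)
  rw [ae_iff] at h
  refine measure_mono_null (fun x hx => ?_) h
  intro H
  have H := H hx (l := 𝓝[>] (0 : ℝ)) (fun r => x + Pi.single i (2 * r)) id tendsto_id
  have H := H (by
    filter_upwards [self_mem_nhdsWithin] with r hr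
    have hr : 0 < r := hr
    simp [dist_self_add_right, Pi.norm_single, abs_of_pos hr])
  have hz : (fun r : ℝ => μ ({x | x i = t} ∩ Metric.closedBall (x + Pi.single i (2 * r)) (id r)) /
      μ (Metric.closedBall (x + Pi.single i (2 * r)) (id r))) =ᶠ[𝓝[>] (0 : ℝ)] fun _ => 0 := by
    filter_upwards [self_mem_nhdsWithin] with r hr
    have hr : 0 < r := hr
    have : {x | x i = t} ∩ Metric.closedBall (x + Pi.single i (2 * r)) (id r) = ∅ := by
      ext y
      simp only [mem_inter_iff, mem_ofPred_eq, Metric.mem_closedBall, id, mem_empty_iff_false,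
        iff_false, not_and, not_le]
      intro hy
      have h1 := dist_le_pi_dist y (x + Pi.single i (2 * r)) i
      have hx : x i = t := hx
      simp only [Pi.add_apply, Pi.single_eq_same, Real.dist_eq, hy, hx] at h1
      have h2 : |t - (t + 2 * r)| = 2 * r := by
        rw [show t - (t + 2 * r) = -(2 * r) by ring, abs_neg, abs_of_pos (by positivity)]
      linarith
    rw [this, measure_empty, ENNReal.zero_div]
  have := tendsto_nhds_unique (tendsto_const_nhds.congr' hz.symm) H
  exact zero_ne_one this

lemma dyadicIndex_preimage_ae_eq (hμ : IsDoubling μ c d) (Q : Cube n) (k : ℕ) (m : Fin n → ℤ) :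
    Q.dyadicIndex k ⁻¹' {m} =ᵐ[μ] (Q.dyadic k m).carrier := by
  have h0 : ∀ᵐ x ∂μ, ∀ i, x i ≠ (Q.dyadic k m).corner i + (Q.dyadic k m).side :=
    ae_all_iff.2 fun i => by
      rw [ae_iff]
      simpa using hμ.measure_hyperplane i _
  filter_upwards [h0] with x hx
  refine propext ⟨fun h => Q.mem_dyadic_of_dyadicIndex_eq h, fun h => ?_⟩
  exact (Q.dyadicIndex_eq_iff k m x).2 fun i => ⟨(h i).1, lt_of_le_of_ne (h i).2 (hx i)⟩

end IsDoubling

namespace IsDoubling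

variable {n : ℕ} {μ : Measure (Fin n → ℝ)} {c d : ℝ}

lemma setAverage_le_of_side_eq (hμ : IsDoubling μ c d) {P P' : Cube n}
    (hP : P.carrier ⊆ P'.carrier) (hside : P'.side = 2 * P.side) {g : (Fin n → ℝ) → ℝ}
    (hg : LocallyIntegrable g μ) (hg0 : ∀ x, 0 ≤ g x) :
    ⨍ x in P.carrier, g x ∂μ ≤ c * 2 ^ d * ⨍ x in P'.carrier, g x ∂μ := by
  have hD := hμ.one_le_const
  have hm : μ.real P'.carrier ≤ c * 2 ^ d * μ.real P.carrier := by
    have h := ENNReal.toReal_mono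
      (ENNReal.mul_ne_top ENNReal.ofReal_ne_top (hμ.2.2.1 P).2.ne)
      (hμ.measure_le_of_side_eq hP hside)
    rwa [ENNReal.toReal_mul, ENNReal.toReal_ofReal (by linarith)] at h
  have hi : ∫ x in P.carrier, g x ∂μ ≤ ∫ x in P'.carrier, g x ∂μ :=
    setIntegral_mono_set (hg.integrableOn_isCompact P'.isCompact_carrier)
      (ae_of_all _ hg0) hP.eventuallyLE
  have hi0 : 0 ≤ ∫ x in P'.carrier, g x ∂μ := integral_nonneg hg0
  have hp := hμ.measure_real_pos P
  have hp' := hμ.measure_real_pos P'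
  rw [setAverage_eq, setAverage_eq, smul_eq_mul, smul_eq_mul, inv_mul_eq_div, inv_mul_eq_div,
    div_le_iff₀ hp]
  calc ∫ x in P.carrier, g x ∂μ ≤ ∫ x in P'.carrier, g x ∂μ := hi
    _ = μ.real P'.carrier * ((∫ x in P'.carrier, g x ∂μ) / μ.real P'.carrier) := by
      field_simp
    _ ≤ (c * 2 ^ d * μ.real P.carrier) * ((∫ x in P'.carrier, g x ∂μ) / μ.real P'.carrier) := by
      gcongr
    _ = _ := by ring

lemma ae_le_of_dyadic_setAverage_le (hμ : IsDoubling μ c d) (Q : Cube n) {g : (Fin n → ℝ) → ℝ}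
    (hg : LocallyIntegrable g μ) (L : ℝ) :
    ∀ᵐ x ∂μ, (∀ k, ⨍ y in (Q.dyadic k (Q.dyadicIndex k x)).carrier, g y ∂μ ≤ L) → g x ≤ L := by
  have := hμ.isLocallyFiniteMeasure
  have := hμ.isUnifLocDoublingMeasure
  filter_upwards [IsUnifLocDoublingMeasure.ae_tendsto_average μ hg 1] with x hx hL
  have hx := hx (l := atTop)
    (fun (k : ℕ) i => (Q.dyadic k (Q.dyadicIndex k x)).corner i +
      (Q.dyadic k (Q.dyadicIndex k x)).side / 2)
    (fun k => (Q.dyadic k (Q.dyadicIndex k x)).side / 2) (by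
      refine tendsto_nhdsWithin_iff.2
        ⟨?_, Eventually.of_forall fun k => half_pos (Q.dyadic k (Q.dyadicIndex k x)).side_pos⟩
      have h : Tendsto (fun k : ℕ => Q.side / 2 * (1 / 2 : ℝ) ^ k) atTop (𝓝 (Q.side / 2 * 0)) :=
        (tendsto_pow_atTop_nhds_zero_of_lt_one (by norm_num) (by norm_num)).const_mul _
      rw [mul_zero] at h
      refine h.congr fun k => ?_
      simp only [Cube.dyadic, one_div, inv_pow]
      ring)
    (Eventually.of_forall fun k => by
      rw [one_mul, ← Cube.carrier_eq_closedBall]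
      exact Q.mem_dyadic_of_dyadicIndex_eq rfl)
  refine le_of_tendsto' hx fun k => ?_
  rw [← Cube.carrier_eq_closedBall]
  exact hL k

/-- Calderón–Zygmund decomposition of a cube with respect to a doubling measure. -/
lemma exists_calderonZygmund (hμ : IsDoubling μ c d) (Q : Cube n) {g : (Fin n → ℝ) → ℝ}
    (hg : LocallyIntegrable g μ) (hg0 : ∀ x, 0 ≤ g x) {L : ℝ}
    (hQ : ⨍ x in Q.carrier, g x ∂μ ≤ L) :
    ∃ (S : Set (ℕ × (Fin n → ℤ))) (P : S → Cube n),
      (∀ s, ⨍ x in (P s).carrier, g x ∂μ ≤ c * 2 ^ d * L) ∧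
      ENNReal.ofReal L * ∑' s, μ (P s).carrier ≤ ∫⁻ x in Q.carrier, ENNReal.ofReal (g x) ∂μ ∧
      ∀ᵐ x ∂μ, x ∈ Q.carrier → (∀ s, x ∉ (P s).carrier) → g x ≤ L := by
  have hD := hμ.one_le_const
  let A : ℕ → (Fin n → ℤ) → ℝ := fun k m => ⨍ x in (Q.dyadic k m).carrier, g x ∂μ
  have hA0 : A 0 0 ≤ L := by simpa only [A, Cube.dyadic_zero] using hQ
  let S : Set (ℕ × (Fin n → ℤ)) := {p | ∃ x, Q.dyadicIndex 0 x = 0 ∧ Q.dyadicIndex p.1 x = p.2 ∧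
    L < A p.1 p.2 ∧ ∀ j < p.1, A j (Q.dyadicIndex j x) ≤ L}
  have hlt : ∀ p ∈ S, ∀ p' ∈ S, ∀ y, Q.dyadicIndex p.1 y = p.2 → Q.dyadicIndex p'.1 y = p'.2 →
      ¬ p.1 < p'.1 := by
    rintro p ⟨-, -, -, hL, -⟩ p' ⟨x', -, hx', -, hj⟩ y hy hy' hpp
    have h1 : Q.dyadicIndex p.1 x' = Q.dyadicIndex p.1 y :=
      Q.dyadicIndex_eq_of_le hpp.le (hx'.trans hy'.symm)
    have := hj p.1 hpp
    rw [h1, hy] at this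
    exact this.not_gt hL
  have hdisj : Pairwise (Function.onFun Disjoint
      fun s : S => Q.dyadicIndex s.1.1 ⁻¹' {s.1.2}) := by
    intro s s' hss
    refine disjoint_left.2 fun y hy hy' => hss ?_
    have e : s.1.1 = s'.1.1 := le_antisymm
      (not_lt.1 (hlt _ s'.2 _ s.2 y hy' hy)) (not_lt.1 (hlt _ s.2 _ s'.2 y hy hy'))
    refine Subtype.ext (Prod.ext e ?_)
    rw [← show Q.dyadicIndex s.1.1 y = s.1.2 from hy, e]
    exact hy'
  refine ⟨S, fun s => Q.dyadic s.1.1 s.1.2, ?_, ?_, ?_⟩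
  · rintro ⟨⟨k, m⟩, x, hx0, hxk, hL, hj⟩
    simp only at hxk hL hj ⊢
    cases k with
    | zero =>
      rw [← hxk, hx0] at hL
      exact absurd hL hA0.not_gt
    | succ k =>
      rw [← hxk]
      refine (hμ.setAverage_le_of_side_eq (Q.dyadic_subset_parent k x) ?_ hg hg0).trans ?_
      · simp only [Cube.dyadic]
        field_simp
        ring
      · have := hj k (Nat.lt_succ_self k)
        gcongr
  · calc ENNReal.ofReal L * ∑' s : S, μ (Q.dyadic s.1.1 s.1.2).carrier
        = ∑' s : S, ENNReal.ofReal L * μ (Q.dyadic s.1.1 s.1.2).carrier := ENNReal.tsum_mul_left.symm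
      _ ≤ ∑' s : S, ∫⁻ x in Q.dyadicIndex s.1.1 ⁻¹' {s.1.2}, ENNReal.ofReal (g x) ∂μ := by
        refine ENNReal.tsum_le_tsum fun s => ?_
        obtain ⟨x, hx0, hxk, hL, hj⟩ := s.2
        rw [setLIntegral_congr (hμ.dyadicIndex_preimage_ae_eq Q _ _)]
        set R := Q.dyadic s.1.1 s.1.2
        have hR := hμ.measure_real_pos R
        have hgi : IntegrableOn g R.carrier μ := hg.integrableOn_isCompact R.isCompact_carrier
        rw [← ofReal_integral_eq_lintegral_ofReal hgi (ae_of_all _ hg0),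
          ← ofReal_measureReal (hμ.2.2.1 R).2.ne, ← ENNReal.ofReal_mul' hR.le]
        refine ENNReal.ofReal_le_ofReal ?_
        have hL' : L < ⨍ x in R.carrier, g x ∂μ := hL
        rw [setAverage_eq, smul_eq_mul, inv_mul_eq_div, lt_div_iff₀ hR] at hL'
        exact hL'.le
      _ = ∫⁻ x in ⋃ s : S, Q.dyadicIndex s.1.1 ⁻¹' {s.1.2}, ENNReal.ofReal (g x) ∂μ :=
        (lintegral_iUnion (fun s => Q.measurable_dyadicIndex _ (measurableSet_singleton _))
          hdisj _).symm
      _ ≤ _ := by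
        refine lintegral_mono_set (iUnion_subset fun s y hy => ?_)
        obtain ⟨x, hx0, hxk, -, -⟩ := s.2
        have hy : Q.dyadicIndex s.1.1 y = s.1.2 := hy
        have := Q.dyadicIndex_eq_of_le (Nat.zero_le s.1.1) (hy.trans hxk.symm)
        simpa only [Cube.dyadic_zero] using Q.mem_dyadic_of_dyadicIndex_eq (this.trans hx0)
  · have h0 := hμ.dyadicIndex_preimage_ae_eq Q 0 0
    rw [Cube.dyadic_zero] at h0
    filter_upwards [hμ.ae_le_of_dyadic_setAverage_le Q hg L, h0.mem_iff] with x hx hx0 hxQ hxP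
    refine hx fun k => ?_
    have hx0 : Q.dyadicIndex 0 x = 0 := hx0.2 hxQ
    induction k using Nat.strong_induction_on with
    | _ k ih =>
      by_contra! hk
      exact hxP ⟨(k, Q.dyadicIndex k x), x, hx0, rfl, hk, ih⟩ (Q.mem_dyadic_of_dyadicIndex_eq rfl)

end IsDoubling

namespace IsDoubling

variable {n : ℕ} {μ : Measure (Fin n → ℝ)} {c d : ℝ}

lemma locallyIntegrable_abs_sub (hμ : IsDoubling μ c d) {f : (Fin n → ℝ) → ℝ}
    (hf : LocallyIntegrable f μ) (a : ℝ) : LocallyIntegrable (fun x => |f x - a|) μ := by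
  have := hμ.isLocallyFiniteMeasure
  exact fun x => ((hf.sub (locallyIntegrable_const a)) x).norm

lemma lintegral_abs_sub_cubeAvg (hμ : IsDoubling μ c d) {f : (Fin n → ℝ) → ℝ}
    (hf : LocallyIntegrable f μ) (Q : Cube n) :
    ∫⁻ x in Q.carrier, ENNReal.ofReal |f x - cubeAvg μ Q f| ∂μ =
      ENNReal.ofReal (osc μ Q f) * μ Q.carrier := by
  have hQ := hμ.measure_real_pos Q
  have hgi := (hμ.locallyIntegrable_abs_sub hf (cubeAvg μ Q f)).integrableOn_isCompact
    Q.isCompact_carrier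
  rw [← ofReal_integral_eq_lintegral_ofReal hgi (ae_of_all _ fun x => abs_nonneg _),
    ← ofReal_measureReal (hμ.2.2.1 Q).2.ne, ← ENNReal.ofReal_mul' hQ.le, osc, setAverage_eq,
    smul_eq_mul]
  congr 1
  field_simp

lemma abs_cubeAvg_sub_le (hμ : IsDoubling μ c d) {f : (Fin n → ℝ) → ℝ}
    (hf : LocallyIntegrable f μ) (P : Cube n) (a : ℝ) :
    |cubeAvg μ P f - a| ≤ ⨍ x in P.carrier, |f x - a| ∂μ := by
  have hP := hμ.measure_real_pos P
  have hgi := hf.integrableOn_isCompact P.isCompact_carrier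
  have hc : IntegrableOn (fun _ => a) P.carrier μ := integrableOn_const (hμ.2.2.1 P).2.ne
  have e : cubeAvg μ P f - a = (μ.real P.carrier)⁻¹ * ∫ x in P.carrier, (f x - a) ∂μ := by
    rw [integral_sub hgi hc, cubeAvg, setAverage_eq, smul_eq_mul, setIntegral_const, smul_eq_mul]
    field_simp
  rw [e, abs_mul, abs_of_pos (inv_pos.2 hP), setAverage_eq, smul_eq_mul]
  gcongr
  exact abs_integral_le_integral_abs

/-- The John–Nirenberg inequality for doubling measures. -/
lemma measure_lt_abs_sub_cubeAvg_le (hμ : IsDoubling μ c d) {f : (Fin n → ℝ) → ℝ}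
    (hf : LocallyIntegrable f μ) {B : ℝ} (hB : 0 < B) (hosc : ∀ P, osc μ P f ≤ B)
    (k : ℕ) (Q : Cube n) :
    μ {x | x ∈ Q.carrier ∧ k * (c * 2 ^ d * (2 * B)) < |f x - cubeAvg μ Q f|} ≤
      2⁻¹ ^ k * μ Q.carrier := by
  induction k generalizing Q with
  | zero =>
    rw [pow_zero, one_mul]
    exact measure_mono fun x hx => hx.1
  | succ k ih =>
    have hD := hμ.one_le_const
    obtain ⟨S, P, hP, hsum, hae⟩ := hμ.exists_calderonZygmund Q
      (hμ.locallyIntegrable_abs_sub hf (cubeAvg μ Q f)) (fun x => abs_nonneg _) (L := 2 * B)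
      ((hosc Q).trans (by linarith))
    have hsub : ∀ᵐ x ∂μ, x ∈ {x | x ∈ Q.carrier ∧
        ((k + 1 : ℕ) : ℝ) * (c * 2 ^ d * (2 * B)) < |f x - cubeAvg μ Q f|} →
        x ∈ ⋃ s, {x | x ∈ (P s).carrier ∧
          k * (c * 2 ^ d * (2 * B)) < |f x - cubeAvg μ (P s) f|} := by
      filter_upwards [hae] with x hx
      rintro ⟨hxQ, hxf⟩
      push_cast at hxf
      have hDB : 2 * B ≤ c * 2 ^ d * (2 * B) := le_mul_of_one_le_left (by positivity) hD
      have hk : 0 ≤ k * (c * 2 ^ d * (2 * B)) := by positivity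
      obtain ⟨s, hs⟩ : ∃ s, x ∈ (P s).carrier := by
        by_contra! H
        linarith [hx hxQ H]
      refine mem_iUnion.2 ⟨s, hs, ?_⟩
      have h1 := (hμ.abs_cubeAvg_sub_le hf (P s) (cubeAvg μ Q f)).trans (hP s)
      have h2 := abs_sub_le (f x) (cubeAvg μ (P s) f) (cubeAvg μ Q f)
      linarith
    have hhalf : ∑' s, μ (P s).carrier ≤ 2⁻¹ * μ Q.carrier := by
      have h : ENNReal.ofReal B * (2 * ∑' s, μ (P s).carrier) ≤
          ENNReal.ofReal B * μ Q.carrier := by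
        calc _ = ENNReal.ofReal (2 * B) * ∑' s, μ (P s).carrier := by
              rw [ENNReal.ofReal_mul zero_le_two, ENNReal.ofReal_ofNat]
              ring
          _ ≤ _ := hsum
          _ ≤ _ := by
            rw [hμ.lintegral_abs_sub_cubeAvg hf]
            gcongr
            exact hosc Q
      rw [ENNReal.mul_le_mul_iff_right (ENNReal.ofReal_pos.2 hB).ne' ENNReal.ofReal_ne_top] at h
      rw [← ENNReal.div_eq_inv_mul, ENNReal.le_div_iff_mul_le (by simp) (by simp), mul_comm]
      exact h
    calc _ ≤ μ (⋃ s, {x | x ∈ (P s).carrier ∧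
          k * (c * 2 ^ d * (2 * B)) < |f x - cubeAvg μ (P s) f|}) := measure_mono_ae hsub
      _ ≤ ∑' s, μ {x | x ∈ (P s).carrier ∧
          k * (c * 2 ^ d * (2 * B)) < |f x - cubeAvg μ (P s) f|} := measure_iUnion_le _
      _ ≤ ∑' s, 2⁻¹ ^ k * μ (P s).carrier := ENNReal.tsum_le_tsum fun s => ih (P s)
      _ = 2⁻¹ ^ k * ∑' s, μ (P s).carrier := ENNReal.tsum_mul_left
      _ ≤ 2⁻¹ ^ k * (2⁻¹ * μ Q.carrier) := by gcongr
      _ = _ := by rw [pow_succ, mul_assoc]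

end IsDoubling

section TailIntegration

variable {α : Type*} [MeasurableSpace α] {ν : Measure α} {g : α → ℝ} {V : ℝ≥0∞}

/-- Integration of a function dominated by layers of a function with geometrically decaying tails. -/
lemma lintegral_ofReal_le_of_geometric_tail (hg : AEMeasurable g ν)
    (htail : ∀ k : ℕ, ν {x | 2 * k < g x} ≤ 2⁻¹ ^ k * V) (huniv : ν univ ≤ V)
    (hgi : ∫⁻ x, ENNReal.ofReal (g x) ∂ν ≤ V) {h : α → ℝ} {w : ℕ → ℝ} {a b C : ℝ}
    (ha : 0 ≤ a) (hb : 0 ≤ b) (hw : ∀ k, 0 ≤ w k)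
    (hsum : ∀ K, ∑ k ∈ Finset.range K, w k * 2⁻¹ ^ k ≤ C) (habC : a + b + C ≤ 1)
    (hh : ∀ x (k : ℕ), g x ≤ 2 * (k + 1) →
      h x ≤ a * g x + (b + ∑ j ∈ Finset.range (k + 1), w j)) :
    ∫⁻ x, ENNReal.ofReal (h x) ∂ν ≤ V := by
  have hC : 0 ≤ C := by simpa using hsum 0
  let s : ℕ → Set α := fun k => {x | 2 * k < g x ∨ k = 0}
  have hs : ∀ k, NullMeasurableSet (s k) ν := fun k =>
    (nullMeasurableSet_lt aemeasurable_const hg).union (MeasurableSet.const _).nullMeasurableSet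
  have hνs : ∀ k, ν (s k) ≤ 2⁻¹ ^ k * V := by
    intro k
    rcases eq_or_ne k 0 with rfl | hk
    · simpa using (measure_mono (subset_univ _)).trans huniv
    · simpa [s, hk] using htail k
  have hpt : ∀ x, ENNReal.ofReal (h x) ≤ ENNReal.ofReal a * ENNReal.ofReal (g x) +
      (ENNReal.ofReal b + ∑' k, (s k).indicator (fun _ => ENNReal.ofReal (w k)) x) := by
    intro x
    have hex : ∃ k : ℕ, g x ≤ 2 * (k + 1) := by
      obtain ⟨k, hk⟩ := exists_nat_ge (g x)
      exact ⟨k, by linarith [(Nat.cast_nonneg k : (0 : ℝ) ≤ k)]⟩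
    classical
    let k := Nat.find hex
    have hk : g x ≤ 2 * (k + 1) := Nat.find_spec hex
    have hmem : ∀ j ∈ Finset.range (k + 1), x ∈ s j := by
      intro j hj
      cases j with
      | zero => exact Or.inr rfl
      | succ j =>
        have := Nat.find_min hex (Nat.lt_of_succ_lt_succ (Finset.mem_range.1 hj))
        left
        push_cast
        exact not_le.1 this
    have hsumk : ENNReal.ofReal (∑ j ∈ Finset.range (k + 1), w j) ≤
        ∑' k, (s k).indicator (fun _ => ENNReal.ofReal (w k)) x := by
      rw [ENNReal.ofReal_sum_of_nonneg fun j _ => hw j]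
      refine le_trans (Finset.sum_le_sum fun j hj => ?_) (ENNReal.sum_le_tsum _)
      rw [indicator_of_mem (hmem j hj)]
    calc ENNReal.ofReal (h x)
        ≤ ENNReal.ofReal (a * g x + (b + ∑ j ∈ Finset.range (k + 1), w j)) :=
          ENNReal.ofReal_le_ofReal (hh x k hk)
      _ ≤ ENNReal.ofReal (a * g x) +
          (ENNReal.ofReal b + ENNReal.ofReal (∑ j ∈ Finset.range (k + 1), w j)) :=
        ENNReal.ofReal_add_le.trans (by gcongr; exact ENNReal.ofReal_add_le)
      _ ≤ _ := by
        rw [ENNReal.ofReal_mul ha]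
        gcongr
  have htsum : ∑' k, ENNReal.ofReal (w k) * 2⁻¹ ^ k ≤ ENNReal.ofReal C := by
    refine ENNReal.tsum_le_of_sum_range_le fun K => ?_
    calc _ = ENNReal.ofReal (∑ k ∈ Finset.range K, w k * 2⁻¹ ^ k) := by
          rw [ENNReal.ofReal_sum_of_nonneg fun k _ => mul_nonneg (hw k) (by positivity)]
          refine Finset.sum_congr rfl fun k _ => ?_
          rw [ENNReal.ofReal_mul (hw k), ENNReal.ofReal_pow (by norm_num),
            ENNReal.ofReal_inv_of_pos two_pos, ENNReal.ofReal_ofNat]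
      _ ≤ _ := ENNReal.ofReal_le_ofReal (hsum K)
  calc ∫⁻ x, ENNReal.ofReal (h x) ∂ν
      ≤ ∫⁻ x, (ENNReal.ofReal a * ENNReal.ofReal (g x) +
        (ENNReal.ofReal b + ∑' k, (s k).indicator (fun _ => ENNReal.ofReal (w k)) x)) ∂ν :=
        lintegral_mono hpt
    _ = ENNReal.ofReal a * ∫⁻ x, ENNReal.ofReal (g x) ∂ν +
        (ENNReal.ofReal b * ν univ + ∑' k, ENNReal.ofReal (w k) * ν (s k)) := by
      rw [lintegral_add_left' (hg.ennreal_ofReal.const_mul _),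
        lintegral_const_mul'' _ hg.ennreal_ofReal, lintegral_add_left measurable_const,
        lintegral_const, lintegral_tsum fun k => aemeasurable_const.indicator₀ (hs k)]
      simp_rw [lintegral_indicator_const₀ (hs _)]
    _ ≤ ENNReal.ofReal a * V + (ENNReal.ofReal b * V +
        ∑' k, ENNReal.ofReal (w k) * (2⁻¹ ^ k * V)) := by
      gcongr with k
      exact hνs k
    _ = (ENNReal.ofReal a + (ENNReal.ofReal b + ∑' k, ENNReal.ofReal (w k) * 2⁻¹ ^ k)) * V := by
      simp_rw [← mul_assoc]
      rw [ENNReal.tsum_mul_right]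
      ring
    _ ≤ (ENNReal.ofReal a + (ENNReal.ofReal b + ENNReal.ofReal C)) * V := by gcongr
    _ = ENNReal.ofReal (a + b + C) * V := by
      rw [← ENNReal.ofReal_add hb hC, ← ENNReal.ofReal_add ha (by positivity), add_assoc]
    _ ≤ 1 * V := by
      gcongr
      exact ENNReal.ofReal_le_one.2 habC
    _ = V := one_mul V

lemma sum_range_sq_mul_geometric_le (K : ℕ) :
    ∑ k ∈ Finset.range K, (3 * (k : ℝ) ^ 2 + 3 * k + 1) * 2⁻¹ ^ k ≤ 26 := by
  have h : ∑ k ∈ Finset.range K, (3 * (k : ℝ) ^ 2 + 3 * k + 1) * 2⁻¹ ^ k =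
      26 - (6 * (K : ℝ) ^ 2 + 18 * K + 26) * 2⁻¹ ^ K := by
    induction K with
    | zero => norm_num
    | succ K ih =>
      rw [Finset.sum_range_succ, ih]
      push_cast
      ring
  rw [h]
  have : 0 ≤ (6 * (K : ℝ) ^ 2 + 18 * K + 26) * 2⁻¹ ^ K := by positivity
  linarith

lemma sum_range_cube_sub (k : ℕ) :
    ∑ j ∈ Finset.range k, (3 * (j : ℝ) ^ 2 + 3 * j + 1) = (k : ℝ) ^ 3 := by
  induction k with
  | zero => norm_num
  | succ k ih =>
    rw [Finset.sum_range_succ, ih]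
    push_cast
    ring

lemma rpow_le_linear_add_cube {p s : ℝ} (hp : 1 ≤ p) (hp3 : p ≤ 3) (hs : 0 < s) :
    s ^ p ≤ (3 - p) / 2 * s + (p - 1) / 2 * s ^ 3 := by
  have h := Real.geom_mean_le_arith_mean2_weighted (w₁ := (3 - p) / 2) (w₂ := (p - 1) / 2)
    (p₁ := s) (p₂ := s ^ 3) (by linarith) (by linarith) hs.le (by positivity) (by ring)
  rw [← Real.rpow_natCast s 3, ← Real.rpow_mul hs.le, ← Real.rpow_add hs] at h
  rw [← Real.rpow_natCast s 3]
  convert h using 2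
  push_cast
  ring

lemma rpow_le_exp {p z : ℝ} (hp : 3 ≤ p) (hz : 0 ≤ z) :
    (z / (2 * (p + 1))) ^ p ≤ 27 / (8 * Real.exp 3) * Real.exp (z / 4) := by
  have hp0 : 0 < p := by linarith
  have h1 : (z / (4 * p)) ^ p ≤ Real.exp (z / 4 - p) := by
    calc (z / (4 * p)) ^ p ≤ Real.exp (z / (4 * p) - 1) ^ p := by
          refine Real.rpow_le_rpow (by positivity) ?_ hp0.le
          linarith [Real.add_one_le_exp (z / (4 * p) - 1)]
      _ = _ := by
        rw [← Real.exp_mul]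
        congr 1
        field_simp
  have h2 : (p / (p + 1)) ^ p ≤ 27 / 64 := by
    have hB := one_add_mul_self_le_rpow_one_add (s := 1 / p) (p := p / 3)
      (by linarith [show 0 < 1 / p by positivity]) (by linarith)
    have e : 1 + p / 3 * (1 / p) = 4 / 3 := by
      field_simp
      norm_num
    rw [e] at hB
    have h3 : (4 / 3 : ℝ) ^ 3 ≤ (1 + 1 / p) ^ p := by
      calc (4 / 3 : ℝ) ^ 3 ≤ ((1 + 1 / p) ^ (p / 3)) ^ 3 := by gcongr
        _ = _ := by
          rw [← Real.rpow_natCast, ← Real.rpow_mul (by positivity)]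
          congr 1
          push_cast
          ring
    have e2 : p / (p + 1) = (1 + 1 / p)⁻¹ := by
      field_simp
    rw [e2, Real.inv_rpow (by positivity)]
    calc _ ≤ ((4 / 3 : ℝ) ^ 3)⁻¹ := by gcongr
      _ = _ := by norm_num
  have h3 : (2 * Real.exp (-1)) ^ p ≤ (2 * Real.exp (-1)) ^ (3 : ℝ) := by
    refine Real.rpow_le_rpow_of_exponent_ge (by positivity) ?_ hp
    rw [Real.exp_neg, ← div_eq_mul_inv, div_le_one (Real.exp_pos 1)]
    linarith [Real.exp_one_gt_d9]
  have e : z / (2 * (p + 1)) = 2 * (p / (p + 1)) * (z / (4 * p)) := by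
    field_simp
    ring
  rw [e, Real.mul_rpow (by positivity) (by positivity), Real.mul_rpow (by positivity)
    (by positivity)]
  calc (2 : ℝ) ^ p * (p / (p + 1)) ^ p * (z / (4 * p)) ^ p
      ≤ 2 ^ p * (27 / 64) * Real.exp (z / 4 - p) := by gcongr
    _ = (2 * Real.exp (-1)) ^ p * (27 / 64) * Real.exp (z / 4) := by
      rw [Real.mul_rpow (by positivity) (by positivity), ← Real.exp_mul, sub_eq_add_neg,
        Real.exp_add]
      ring_nf
    _ ≤ (2 * Real.exp (-1)) ^ (3 : ℝ) * (27 / 64) * Real.exp (z / 4) := by gcongr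
    _ = _ := by
      rw [Real.mul_rpow (by positivity) (by positivity), ← Real.exp_mul,
        show (-1 : ℝ) * 3 = -3 by norm_num, Real.exp_neg]
      norm_num
      field_simp
      norm_num

lemma lintegral_max_rpow_le (hg : AEMeasurable g ν) (hg0 : ∀ x, 0 ≤ g x)
    (htail : ∀ k : ℕ, ν {x | 2 * k < g x} ≤ 2⁻¹ ^ k * V) (huniv : ν univ ≤ V)
    (hgi : ∫⁻ x, ENNReal.ofReal (g x) ∂ν ≤ V) {p : ℝ} (hp : 1 ≤ p) :
    ∫⁻ x, ENNReal.ofReal (max (g x / (2 * (p + 1))) ((g x / (2 * (p + 1))) ^ p)) ∂ν ≤ V := by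
  rcases le_total p 3 with hp3 | hp3
  · set b := (p - 1) / 2 / (2 * (p + 1)) ^ 3 with hb
    have hb0 : 0 ≤ b := div_nonneg (by linarith) (by positivity)
    refine lintegral_ofReal_le_of_geometric_tail hg htail huniv hgi
      (a := 1 / (2 * (p + 1))) (b := 0) (C := 8 * b * 26)
      (w := fun k => 8 * b * (3 * (k : ℝ) ^ 2 + 3 * k + 1)) (by positivity) le_rfl
      (fun k => by positivity) ?_ ?_ ?_
    · intro K
      simp_rw [mul_assoc (8 * b), ← Finset.mul_sum]
      gcongr
      exact sum_range_sq_mul_geometric_le K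
    · have e : 1 / (2 * (p + 1)) + 0 + 8 * b * 26 =
          ((p + 1) ^ 2 / 2 + 13 * (p - 1)) / (p + 1) ^ 3 := by
        rw [hb]
        field_simp
        ring
      rw [e, div_le_one (by positivity)]
      nlinarith [sq_nonneg (p - 1.25), mul_nonneg (sub_nonneg.2 hp) (sq_nonneg (p - 1.25))]
    · intro x k hk
      have hz := hg0 x
      simp_rw [← Finset.mul_sum, sum_range_cube_sub]
      have hcube : b * g x ^ 3 ≤ 8 * b * ((k + 1 : ℕ) : ℝ) ^ 3 := by
        calc b * g x ^ 3 ≤ b * (2 * (k + 1)) ^ 3 := by gcongr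
          _ = _ := by
            push_cast
            ring
      have e : (p - 1) / 2 * (g x / (2 * (p + 1))) ^ 3 = b * g x ^ 3 := by
        rw [hb, div_pow]
        ring
      have hs : 0 ≤ g x / (2 * (p + 1)) := by positivity
      have e' : 1 / (2 * (p + 1)) * g x = g x / (2 * (p + 1)) := by ring
      rw [e', zero_add]
      refine le_trans ?_ (add_le_add le_rfl hcube)
      have hcube0 : 0 ≤ b * g x ^ 3 := by positivity
      refine max_le (by linarith) ?_
      rcases hs.eq_or_lt with h0 | hpos
      · rw [← h0, Real.zero_rpow (by linarith)]
        linarith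
      · have := rpow_le_linear_add_cube hp hp3 hpos
        rw [e] at this
        nlinarith
  · set u := Real.exp (1 / 2) with hu
    set b := 27 / (8 * Real.exp 3) with hb
    have hb0 : 0 ≤ b := by positivity
    have hu1 : 1 < u := Real.one_lt_exp_iff.2 (by norm_num)
    have hu2 : u < 1.65 := by
      have : u ^ 2 = Real.exp 1 := by
        rw [hu, ← Real.exp_nat_mul]
        norm_num
      nlinarith [Real.exp_one_lt_d9]
    have hb' : b ≤ 0.1681 := by
      have : Real.exp 3 = Real.exp 1 ^ 3 := by
        rw [← Real.exp_nat_mul]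
        norm_num
      rw [hb, this, div_le_iff₀ (by positivity)]
      have : (2.718 : ℝ) ^ 3 ≤ Real.exp 1 ^ 3 := by
        gcongr
        linarith [Real.exp_one_gt_d9]
      norm_num at this ⊢
      linarith
    refine lintegral_ofReal_le_of_geometric_tail hg htail huniv hgi
      (a := 1 / (2 * (p + 1))) (b := b) (C := b * ((u - 1) / (1 - u / 2)))
      (w := fun k => b * (u ^ (k + 1) - u ^ k)) (by positivity) hb0 ?_ ?_ ?_ ?_
    · intro k
      exact mul_nonneg hb0 (sub_nonneg.2 (pow_le_pow_right₀ hu1.le (Nat.le_succ k)))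
    · intro K
      have e : ∀ k : ℕ, b * (u ^ (k + 1) - u ^ k) * 2⁻¹ ^ k = b * (u - 1) * (u / 2) ^ k := by
        intro k
        rw [div_eq_mul_inv, mul_pow]
        ring
      simp_rw [e, ← Finset.mul_sum]
      rw [mul_assoc, div_eq_mul_inv (u - 1), ← tsum_geometric_of_lt_one (by linarith) (by linarith)]
      have hsummable : Summable fun k : ℕ => (u / 2) ^ k :=
        summable_geometric_of_lt_one (by linarith) (by linarith)
      refine mul_le_mul_of_nonneg_left (mul_le_mul_of_nonneg_left ?_ (by linarith)) hb0
      exact hsummable.sum_le_tsum _ fun k _ => pow_nonneg (by linarith) k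
    · have h1 : 1 / (2 * (p + 1)) ≤ 1 / 8 := by
        gcongr
        linarith
      have h2 : (u - 1) / (1 - u / 2) ≤ 3.72 := by
        rw [div_le_iff₀ (by linarith)]
        linarith
      nlinarith
    · intro x k hk
      have hz := hg0 x
      rw [← Finset.mul_sum, Finset.sum_range_sub (fun k => u ^ k)]
      have e' : 1 / (2 * (p + 1)) * g x = g x / (2 * (p + 1)) := by ring
      have hexp : Real.exp (g x / 4) ≤ u ^ (k + 1) := by
        rw [hu, ← Real.exp_nat_mul]
        refine Real.exp_le_exp.2 ?_
        push_cast
        linarith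
      have hpos : 0 ≤ b * Real.exp (g x / 4) := by positivity
      have hle : b * Real.exp (g x / 4) ≤ b * u ^ (k + 1) := by gcongr
      have hs : 0 ≤ g x / (2 * (p + 1)) := by positivity
      rw [e', pow_zero]
      have := rpow_le_exp hp3 hz
      refine max_le ?_ ?_ <;> linarith

end TailIntegration

section Young

variable {φ : ℝ → ℝ}

namespace IsYoung

lemma le_self (hφ : IsYoung φ) {s : ℝ} (h0 : 0 ≤ s) (h1 : s ≤ 1) : φ s ≤ s := by
  have h := hφ.1.2 (x := 0) (y := 1) (by simp) (by simp) (sub_nonneg.2 h1) h0 (by ring)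
  simpa [hφ.2.1, hφ.2.2.1] using h

lemma self_le (hφ : IsYoung φ) {t : ℝ} (h1 : 1 ≤ t) : t ≤ φ t := by
  have ht : 0 < t := by linarith
  have h := hφ.1.2 (x := 0) (y := t) (by simp) (by simpa using ht.le)
    (sub_nonneg.2 (inv_le_one_of_one_le₀ h1)) (inv_nonneg.2 ht.le) (by ring)
  simp only [smul_eq_mul, mul_zero, zero_add, hφ.2.1, inv_mul_cancel₀ ht.ne', hφ.2.2.1] at h
  rwa [inv_mul_eq_div, le_div_iff₀ ht, one_mul] at h

lemma continuousOn_mul_rpow (hφ : IsYoung φ) (q : ℝ) :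
    ContinuousOn (fun t => φ t * t ^ q) (Ici 1) := by
  have hc : ContinuousOn φ (Ici 1) := by
    have h := hφ.1.continuousOn_interior
    rw [interior_Ici] at h
    exact h.mono fun t ht => mem_Ioi.2 (lt_of_lt_of_le one_pos (mem_Ici.1 ht))
  refine hc.mul (continuousOn_id.rpow_const fun t ht => Or.inl ?_)
  exact (lt_of_lt_of_le one_pos ht).ne'

end IsYoung

lemma hasDerivAt_mul_rpow_neg {φ' : ℝ → ℝ} {t : ℝ} (ht : 1 < t) (h : HasDerivAt φ (φ' t) t)
    (q : ℝ) : HasDerivAt (fun t => φ t * t ^ (-q)) ((t * φ' t - q * φ t) * t ^ (-q - 1)) t := by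
  have ht0 : 0 < t := by linarith
  refine (h.mul (Real.hasDerivAt_rpow_const (p := -q) (Or.inl ht0.ne'))).congr_deriv ?_
  have : t ^ (-q) = t * t ^ (-q - 1) := by
    rw [Real.rpow_sub_one ht0.ne']
    field_simp
  rw [this]
  ring

lemma IsYoung.le_rpow (hφ : IsYoung φ) {φ' : ℝ → ℝ}
    (hder : ∀ t : ℝ, 1 < t → HasDerivAt φ (φ' t) t) {q : ℝ}
    (hup : ∀ t : ℝ, 1 < t → t * φ' t ≤ q * φ t) {t : ℝ} (ht : 1 ≤ t) : φ t ≤ t ^ q := by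
  have hanti : AntitoneOn (fun t => φ t * t ^ (-q)) (Ici 1) := by
    refine antitoneOn_of_deriv_nonpos (convex_Ici 1) (hφ.continuousOn_mul_rpow (-q)) ?_ ?_
    all_goals
      rw [interior_Ici]
      intro s hs
      have hd := hasDerivAt_mul_rpow_neg hs (hder s hs) q
    · exact hd.differentiableAt.differentiableWithinAt
    · rw [hd.deriv]
      exact mul_nonpos_of_nonpos_of_nonneg (sub_nonpos.2 (hup s hs))
        (Real.rpow_nonneg (zero_le_one.trans (le_of_lt hs)) _)
  have ht0 : 0 < t := by linarith
  have h := hanti (mem_Ici.2 le_rfl) (mem_Ici.2 ht) ht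
  simp only [hφ.2.2.1, Real.one_rpow, mul_one, Real.rpow_neg ht0.le] at h
  rwa [← div_eq_mul_inv, div_le_one (Real.rpow_pos_of_pos ht0 q)] at h

lemma IsYoung.rpow_le (hφ : IsYoung φ) {φ' : ℝ → ℝ}
    (hder : ∀ t : ℝ, 1 < t → HasDerivAt φ (φ' t) t) {q : ℝ}
    (hlow : ∀ t : ℝ, 1 < t → q * φ t ≤ t * φ' t) {t : ℝ} (ht : 1 ≤ t) : t ^ q ≤ φ t := by
  have hmono : MonotoneOn (fun t => φ t * t ^ (-q)) (Ici 1) := by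
    refine monotoneOn_of_deriv_nonneg (convex_Ici 1) (hφ.continuousOn_mul_rpow (-q)) ?_ ?_
    all_goals
      rw [interior_Ici]
      intro s hs
      have hd := hasDerivAt_mul_rpow_neg hs (hder s hs) q
    · exact hd.differentiableAt.differentiableWithinAt
    · rw [hd.deriv]
      exact mul_nonneg (sub_nonneg.2 (hlow s hs))
        (Real.rpow_nonneg (zero_le_one.trans (le_of_lt hs)) _)
  have ht0 : 0 < t := by linarith
  have h := hmono (mem_Ici.2 le_rfl) (mem_Ici.2 ht) ht
  simp only [hφ.2.2.1, Real.one_rpow, mul_one, Real.rpow_neg ht0.le] at h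
  rwa [← div_eq_mul_inv, one_le_div (Real.rpow_pos_of_pos ht0 q)] at h

lemma IsYoung.two_le (hφ : IsYoung φ) {φ' : ℝ → ℝ}
    (hder : ∀ t : ℝ, 1 < t → HasDerivAt φ (φ' t) t) {q : ℝ} (hq : 0 < q)
    (hlow : ∀ t : ℝ, 1 < t → q * φ t ≤ t * φ' t) {t : ℝ} (ht : 1 + 1 / q ≤ t) : 2 ≤ φ t := by
  have hq' : 0 < 1 / q := by positivity
  have ht1 : 1 ≤ t := by linarith
  rcases le_total q 1 with h | h
  · have : 1 ≤ 1 / q := (one_le_div hq).2 h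
    linarith [hφ.self_le ht1]
  · have hB := one_add_mul_self_le_rpow_one_add (s := 1 / q) (by linarith) h
    rw [mul_one_div_cancel hq.ne'] at hB
    calc (2 : ℝ) ≤ (1 + 1 / q) ^ q := by linarith
      _ ≤ t ^ q := by gcongr
      _ ≤ φ t := hφ.rpow_le hder hlow ht1

end Young

lemma luxNorm_le {n : ℕ} {φ : ℝ → ℝ} {ν : Measure (Fin n → ℝ)} {Q : Cube n}
    {f : (Fin n → ℝ) → ℝ} {l : ℝ} (hl : 0 < l)
    (h : ∫⁻ x in Q.carrier, ENNReal.ofReal (φ (|f x| / l)) ∂ν ≤ ν Q.carrier) :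
    luxNorm φ ν Q f ≤ l :=
  csInf_le ⟨0, fun _ hx => hx.1.le⟩ ⟨hl, h⟩

/-- The local `φ(L)` norm of the oscillation, in terms of any bound `B` for the mean oscillations
and the upper growth exponent `p` of `φ`. -/
lemma IsDoubling.luxNorm_sub_cubeAvg_le {n : ℕ} {μ : Measure (Fin n → ℝ)} {c d : ℝ}
    (hμ : IsDoubling μ c d) {φ : ℝ → ℝ} {p M : ℝ} (hp : 1 ≤ p)
    (hφ1 : ∀ s, 0 ≤ s → s ≤ 1 → φ s ≤ s) (hφp : ∀ s, 1 ≤ s → φ s ≤ s ^ p)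
    (hM : 2 * (p + 1) ≤ M) {f : (Fin n → ℝ) → ℝ} (hf : LocallyIntegrable f μ) {B : ℝ}
    (hB : 0 < B) (hosc : ∀ P, osc μ P f ≤ B) (Q : Cube n) :
    luxNorm φ μ Q (fun x => f x - cubeAvg μ Q f) ≤ c * 2 ^ d * M * B := by
  have hD := hμ.one_le_const
  have hDB : 0 < c * 2 ^ d * B := by positivity
  have hM0 : 0 < M := by linarith
  refine luxNorm_le (by positivity) ?_
  set g : (Fin n → ℝ) → ℝ := fun x => |f x - cubeAvg μ Q f| / (c * 2 ^ d * B) with hg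
  have hg0 : ∀ x, 0 ≤ g x := fun x => by positivity
  have hloc := hμ.locallyIntegrable_abs_sub hf (cubeAvg μ Q f)
  have hgm : AEMeasurable g (μ.restrict Q.carrier) :=
    (hloc.aestronglyMeasurable.aemeasurable.restrict).div_const _
  have htail : ∀ k : ℕ, μ.restrict Q.carrier {x | 2 * k < g x} ≤ 2⁻¹ ^ k * μ Q.carrier := by
    intro k
    rw [Measure.restrict_apply₀' Q.measurableSet_carrier.nullMeasurableSet]
    refine le_trans (measure_mono ?_) (hμ.measure_lt_abs_sub_cubeAvg_le hf hB hosc k Q)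
    rintro x ⟨hx, hxQ⟩
    refine ⟨hxQ, ?_⟩
    have hx : 2 * k < |f x - cubeAvg μ Q f| / (c * 2 ^ d * B) := hx
    rw [lt_div_iff₀ hDB] at hx
    linarith
  have hgi : ∫⁻ x in Q.carrier, ENNReal.ofReal (g x) ∂μ ≤ μ Q.carrier := by
    calc ∫⁻ x in Q.carrier, ENNReal.ofReal (g x) ∂μ
        = ∫⁻ x in Q.carrier, ENNReal.ofReal (c * 2 ^ d * B)⁻¹ *
          ENNReal.ofReal |f x - cubeAvg μ Q f| ∂μ := by
          refine lintegral_congr fun x => ?_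
          rw [← ENNReal.ofReal_mul (by positivity), inv_mul_eq_div]
      _ = ENNReal.ofReal (c * 2 ^ d * B)⁻¹ * (ENNReal.ofReal (osc μ Q f) * μ Q.carrier) := by
        rw [lintegral_const_mul' _ _ ENNReal.ofReal_ne_top, hμ.lintegral_abs_sub_cubeAvg hf]
      _ = ENNReal.ofReal ((c * 2 ^ d * B)⁻¹ * osc μ Q f) * μ Q.carrier := by
        rw [← mul_assoc, ← ENNReal.ofReal_mul (by positivity)]
      _ ≤ 1 * μ Q.carrier := by
        gcongr
        refine ENNReal.ofReal_le_one.2 ?_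
        rw [inv_mul_eq_div, div_le_one hDB]
        exact (hosc Q).trans (le_mul_of_one_le_left hB.le hD)
      _ = μ Q.carrier := one_mul _
  refine le_trans (lintegral_mono fun x => ENNReal.ofReal_le_ofReal ?_)
    (lintegral_max_rpow_le hgm hg0 htail (by simp) hgi hp)
  have hs : |f x - cubeAvg μ Q f| / (c * 2 ^ d * M * B) ≤ g x / (2 * (p + 1)) := by
    rw [hg, div_div]
    refine div_le_div_of_nonneg_left (abs_nonneg _) (by positivity) ?_
    calc c * 2 ^ d * B * (2 * (p + 1)) ≤ c * 2 ^ d * B * M := by gcongr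
      _ = _ := by ring
  have hs0 : 0 ≤ |f x - cubeAvg μ Q f| / (c * 2 ^ d * M * B) := by positivity
  rcases le_total (|f x - cubeAvg μ Q f| / (c * 2 ^ d * M * B)) 1 with h | h
  · exact le_max_of_le_left ((hφ1 _ hs0 h).trans hs)
  · refine le_max_of_le_right ((hφp _ h).trans ?_)
    exact Real.rpow_le_rpow hs0 hs (by linarith)

/-- Corollary 4.5: let `φ` be a quasi-submultiplicative Young function with constant
`csub`, differentiable for `t > 1`, with `[φ]₁ φ(t) ≤ t φ'(t) ≤ [φ]₂ φ(t)` for `t > 1`.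
Then for every cube `Q` and every `f ∈ BMO(dμ)`,
`‖f − f_{Q,μ}‖_{φ(L)(Q, dμ/μ(Q))} ≤ c_μ 2^{n_μ} φ(csub (1 + 1/[φ]₁)) ([φ]₂ + 1) ‖f‖_{BMO(dμ)}`. -/
theorem statement6 {n : ℕ} (μ : Measure (Fin n → ℝ)) (c d : ℝ) (hμ : IsDoubling μ c d)
    (φ : ℝ → ℝ) (hφ : IsYoung φ) (csub : ℝ) (hcsub : 0 < csub)
    (hqsub : ∀ t₁ t₂ : ℝ, 0 ≤ t₁ → 0 ≤ t₂ → φ (t₁ * t₂) ≤ csub * φ t₁ * φ t₂)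
    (φ' : ℝ → ℝ) (hder : ∀ t : ℝ, 1 < t → HasDerivAt φ (φ' t) t)
    (C₁ C₂ : ℝ) (hC₁ : 0 < C₁) (hC₂ : 0 < C₂)
    (hlow : ∀ t : ℝ, 1 < t → C₁ * φ t ≤ t * φ' t)
    (hup : ∀ t : ℝ, 1 < t → t * φ' t ≤ C₂ * φ t)
    (Q : Cube n) (f : (Fin n → ℝ) → ℝ) (hf : MemBMO μ f) :
    luxNorm φ μ Q (fun x => f x - cubeAvg μ Q f) ≤
      c * 2 ^ d * φ (csub * (1 + 1 / C₁)) * (C₂ + 1) * bmoNorm μ f := by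
  have h11 := hqsub 1 1 zero_le_one zero_le_one
  rw [mul_one, hφ.2.2.1, mul_one, mul_one] at h11
  have hC₂1 : 1 ≤ C₂ := by
    have h := (hφ.self_le one_le_two).trans (hφ.le_rpow hder hup one_le_two)
    by_contra! hlt
    have := Real.rpow_lt_rpow_of_exponent_lt (one_lt_two : (1 : ℝ) < 2) hlt
    rw [Real.rpow_one] at this
    linarith
  have h2 : 2 ≤ φ (csub * (1 + 1 / C₁)) :=
    hφ.two_le hder hC₁ hlow (le_mul_of_one_le_left (by positivity) h11)
  have hD := hμ.one_le_const
  set K := c * 2 ^ d * φ (csub * (1 + 1 / C₁)) * (C₂ + 1) with hK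
  have key : ∀ ε : ℝ, 0 < ε →
      luxNorm φ μ Q (fun x => f x - cubeAvg μ Q f) ≤ K * (bmoNorm μ f + ε) := by
    intro ε hε
    have hle : ∀ P, osc μ P f ≤ bmoNorm μ f := fun P => le_ciSup hf.2 P
    have hosc0 : 0 ≤ osc μ Q f := by
      rw [osc, setAverage_eq]
      exact smul_nonneg (by positivity) (integral_nonneg fun x => abs_nonneg _)
    refine (hμ.luxNorm_sub_cubeAvg_le (M := φ (csub * (1 + 1 / C₁)) * (C₂ + 1)) hC₂1
      (fun s => hφ.le_self) (fun s => hφ.le_rpow hder hup) (by gcongr) hf.1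
      (B := bmoNorm μ f + ε) (by linarith [hle Q]) (fun P => by linarith [hle P]) Q).trans_eq ?_
    rw [hK]
    ring
  have hlim : Tendsto (fun ε : ℝ => K * (bmoNorm μ f + ε)) (𝓝[>] 0) (𝓝 (K * (bmoNorm μ f + 0))) :=
    tendsto_nhdsWithin_of_tendsto_nhds (Continuous.tendsto (by fun_prop) 0)
  rw [add_zero] at hlim
  exact ge_of_tendsto hlim (eventually_nhdsWithin_of_forall key)

end
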